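/- The identity checking problem for the Kauffman monoid K_3 is decidable: the binary relation on words over a countably infinite decidable alphabet X consisting of the pairs (w, w') such that the identity w ≍ w' holds in K_3 is a decidable relation. -/

import Mathlib

open scoped Classical

/-- Generators of the Kauffman monoid `K₃`. -/
inductive K3Gen : Type
  | h1 | h2 | c
deriving DecidableEq

namespace K3Gen

/-- The defining relations of the Kauffman monoid `K₃`:
`h₁h₂h₁ = h₁`, `h₂h₁h₂ = h₂`, `h₁² = ch₁ = h₁c`, `h₂² = ch₂ = h₂c`. -/
inductive K3Rel : FreeMonoid K3Gen → FreeMonoid K3Gen → Prop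
  | braid1 : K3Rel (.of h1 * .of h2 * .of h1) (.of h1)
  | braid2 : K3Rel (.of h2 * .of h1 * .of h2) (.of h2)
  | sq1 : K3Rel (.of h1 * .of h1) (.of c * .of h1)
  | comm1 : K3Rel (.of c * .of h1) (.of h1 * .of c)
  | sq2 : K3Rel (.of h2 * .of h2) (.of c * .of h2)
  | comm2 : K3Rel (.of c * .of h2) (.of h2 * .of c)

end K3Gen

/-- The congruence on the free monoid over the generators generated by the relations. -/
def K3Con : Con (FreeMonoid K3Gen) := conGen K3Gen.K3Rel

/-- The Kauffman monoid `K₃`. -/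
def K3 : Type := K3Con.Quotient

instance : Monoid K3 := Con.monoid K3Con

namespace K3

/-- The generator `h₁` of `K₃`. -/
def h1 : K3 := K3Con.mk' (.of .h1)
/-- The generator `h₂` of `K₃`. -/
def h2 : K3 := K3Con.mk' (.of .h2)
/-- The generator `c` of `K₃`. -/
def c : K3 := K3Con.mk' (.of .c)

end K3

/-- The identity `w ≍ w'` (words over the countably infinite alphabet `ℕ`) holds in the
monoid `M` if every monoid homomorphism from the free monoid over `ℕ` to `M` equalizes
`w` and `w'`. -/
def HoldsIn (M : Type*) [Monoid M] (w w' : List ℕ) : Prop :=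
  ∀ φ : FreeMonoid ℕ →* M, φ (FreeMonoid.ofList w) = φ (FreeMonoid.ofList w')

/-- Concrete model: `(none, n)` is `c^n`, `(some (i,j), n)` is `c^n e_{ij}`. -/
def KM : Type := Option (Bool × Bool) × ℕ

namespace KM

/-- Multiplication on the type component. -/
def tmul : Option (Bool × Bool) → Option (Bool × Bool) → Option (Bool × Bool)
  | none, u => u
  | some a, none => some a
  | some a, some b => some (a.1, b.2)

/-- Number of circles created. -/
def tk : Option (Bool × Bool) → Option (Bool × Bool) → ℕ
  | none, _ => 0
  | some _, none => 0
  | some a, some b => bif a.2 == b.1 then 1 else 0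

/-- Multiplication. -/
def mulK (x y : KM) : KM := (tmul x.1 y.1, x.2 + y.2 + tk x.1 y.1)

theorem tmul_assoc : ∀ a b d, tmul (tmul a b) d = tmul a (tmul b d) := by decide

theorem tk_assoc : ∀ a b d, tk a b + tk (tmul a b) d = tk b d + tk a (tmul b d) := by decide

instance : Monoid KM where
  mul := mulK
  one := (none, 0)
  mul_assoc a b d := by
    have h := tk_assoc a.1 b.1 d.1
    refine Prod.ext (tmul_assoc _ _ _) ?_
    change a.2 + b.2 + tk a.1 b.1 + d.2 + tk (tmul a.1 b.1) d.1
      = a.2 + (b.2 + d.2 + tk b.1 d.1) + tk a.1 (tmul b.1 d.1)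
    omega
  one_mul a := by
    refine Prod.ext rfl ?_
    change 0 + a.2 + 0 = a.2
    omega
  mul_one a := by
    obtain ⟨_ | a, n⟩ := a <;> rfl

theorem mul_def (x y : KM) : x * y = mulK x y := rfl

theorem one_def : (1 : KM) = ((none, 0) : Option (Bool × Bool) × ℕ) := rfl

/-- Images of the generators. -/
def gen : K3Gen → KM
  | .h1 => (some (false, false), 0)
  | .h2 => (some (true, true), 0)
  | .c => (none, 1)

/-- The map `K₃ → KM`. -/
def toKM : K3 →* KM := K3Con.lift (FreeMonoid.lift gen) (by
  unfold K3Con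
  rw [Con.conGen_le]
  intro x y h
  cases h <;> rfl)

/-- Matrix unit words. -/
def e : Option (Bool × Bool) → K3
  | none => 1
  | some (false, false) => K3.h1
  | some (false, true) => K3.h1 * K3.h2
  | some (true, false) => K3.h2 * K3.h1
  | some (true, true) => K3.h2

/-- The map `KM → K₃`. -/
def ofKM (x : KM) : K3 := K3.c ^ x.2 * e x.1

theorem b1 : K3.h1 * K3.h2 * K3.h1 = K3.h1 :=
  (Con.eq K3Con).2 (ConGen.Rel.of _ _ K3Gen.K3Rel.braid1)
theorem b2 : K3.h2 * K3.h1 * K3.h2 = K3.h2 :=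
  (Con.eq K3Con).2 (ConGen.Rel.of _ _ K3Gen.K3Rel.braid2)
theorem s1 : K3.h1 * K3.h1 = K3.c * K3.h1 :=
  (Con.eq K3Con).2 (ConGen.Rel.of _ _ K3Gen.K3Rel.sq1)
theorem s2 : K3.h2 * K3.h2 = K3.c * K3.h2 :=
  (Con.eq K3Con).2 (ConGen.Rel.of _ _ K3Gen.K3Rel.sq2)
theorem c1 : K3.c * K3.h1 = K3.h1 * K3.c :=
  (Con.eq K3Con).2 (ConGen.Rel.of _ _ K3Gen.K3Rel.comm1)
theorem c2 : K3.c * K3.h2 = K3.h2 * K3.c :=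
  (Con.eq K3Con).2 (ConGen.Rel.of _ _ K3Gen.K3Rel.comm2)

theorem comm_e : ∀ t, Commute K3.c (e t)
  | none => Commute.one_right _
  | some (false, false) => c1
  | some (false, true) => Commute.mul_right c1 c2
  | some (true, false) => Commute.mul_right c2 c1
  | some (true, true) => c2

theorem b1' (x : K3) : K3.h1 * (K3.h2 * (K3.h1 * x)) = K3.h1 * x := by
  simp only [← mul_assoc, b1]
theorem b2' (x : K3) : K3.h2 * (K3.h1 * (K3.h2 * x)) = K3.h2 * x := by
  simp only [← mul_assoc, b2]
theorem s1' (x : K3) : K3.h1 * (K3.h1 * x) = K3.c * (K3.h1 * x) := by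
  simp only [← mul_assoc, s1]
theorem s2' (x : K3) : K3.h2 * (K3.h2 * x) = K3.c * (K3.h2 * x) := by
  simp only [← mul_assoc, s2]
theorem c1' (x : K3) : K3.h1 * (K3.c * x) = K3.c * (K3.h1 * x) := by
  simp only [← mul_assoc, c1]
theorem c2' (x : K3) : K3.h2 * (K3.c * x) = K3.c * (K3.h2 * x) := by
  simp only [← mul_assoc, c2]

theorem e_mul (a b) : e a * e b = K3.c ^ tk a b * e (tmul a b) := by
  have b1'' := b1
  have b2'' := b2
  rw [mul_assoc] at b1'' b2''
  rcases a with _ | ⟨_ | _, _ | _⟩ <;> rcases b with _ | ⟨_ | _, _ | _⟩ <;>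
    simp [e, tk, tmul, mul_assoc, s1', s2', s1, s2, b1'', b2'', c1', c2']

theorem ofKM_mul (x y : KM) : ofKM (x * y) = ofKM x * ofKM y := by
  change K3.c ^ (x.2 + y.2 + tk x.1 y.1) * e (tmul x.1 y.1) = _
  unfold ofKM
  have h : Commute (K3.c ^ y.2) (e x.1) := (comm_e x.1).pow_left _
  rw [mul_assoc, ← mul_assoc (e x.1), ← h.eq, mul_assoc (K3.c ^ y.2), e_mul, pow_add, pow_add]
  simp only [mul_assoc]

/-- The map `KM → K₃` as a homomorphism. -/
def ofHom : KM →* K3 where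
  toFun := ofKM
  map_one' := by change K3.c ^ 0 * 1 = 1; simp
  map_mul' := ofKM_mul

theorem ofHom_toKM (x : K3) : ofHom (toKM x) = x := by
  have : (ofHom.comp toKM).comp K3Con.mk' = K3Con.mk' := by
    apply FreeMonoid.hom_eq
    intro g
    cases g
    · change K3.c ^ 0 * K3.h1 = K3.h1; simp
    · change K3.c ^ 0 * K3.h2 = K3.h2; simp
    · change K3.c ^ 1 * 1 = K3.c; simp
  obtain ⟨y, rfl⟩ := Con.mk'_surjective (c := K3Con) x
  exact DFunLike.congr_fun this y

theorem toKM_c_pow (n : ℕ) : (toKM K3.c) ^ n = ((none, n) : Option (Bool × Bool) × ℕ) := by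
  induction n with
  | zero => rfl
  | succ n ih => rw [pow_succ, ih]; rfl

theorem toKM_ofHom (x : KM) : toKM (ofHom x) = x := by
  obtain ⟨t, n⟩ := x
  change toKM (K3.c ^ n * e t) = _
  rw [map_mul, map_pow, toKM_c_pow]
  rcases t with _ | ⟨_ | _, _ | _⟩ <;> rfl

theorem holds_iff (w w' : List ℕ) : HoldsIn K3 w w' ↔ HoldsIn KM w w' := by
  constructor
  · intro h φ
    have := congrArg toKM (h (ofHom.comp φ))
    simpa [toKM_ofHom] using this
  · intro h φ
    have := congrArg ofHom (h (toKM.comp φ))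
    simpa [ofHom_toKM] using this

/-- Evaluation of a word. -/
def ev (g : ℕ → KM) (w : List ℕ) : KM := (w.map g).prod

theorem holds_iff_ev (w w' : List ℕ) : HoldsIn KM w w' ↔ ∀ g, ev g w = ev g w' := by
  constructor
  · intro h g
    have := h (FreeMonoid.lift g)
    simpa [FreeMonoid.lift_apply, ev] using this
  · intro h φ
    have := h (fun x => φ (FreeMonoid.of x))
    have key : ∀ v, φ (FreeMonoid.ofList v) = ev (fun x => φ (FreeMonoid.of x)) v := by
      intro v
      induction v with
      | nil => exact map_one φ
      | cons a v ih =>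
        rw [FreeMonoid.ofList_cons, map_mul, ih]
        simp [ev]
    rw [key, key, this]

/-- Codes for the test elements. -/
def dec (d : Fin 6) : KM :=
  match d with
  | 0 => (none, 0)
  | 1 => (some (false, false), 0)
  | 2 => (some (false, true), 0)
  | 3 => (some (true, false), 0)
  | 4 => (some (true, true), 0)
  | 5 => (none, 1)

/-- Encoding of types. -/
def enc : Option (Bool × Bool) → Fin 6
  | none => 0
  | some (false, false) => 1
  | some (false, true) => 2
  | some (true, false) => 3
  | some (true, true) => 4

theorem dec_enc (t) : dec (enc t) = ((t, 0) : Option (Bool × Bool) × ℕ) := by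
  rcases t with _ | ⟨_ | _, _ | _⟩ <;> rfl

theorem ev_split (g : ℕ → KM) (w : List ℕ) :
    ev g w = (((ev (fun x => dec (enc (g x).1)) w).1,
      (w.map (fun x => (g x).2)).sum + (ev (fun x => dec (enc (g x).1)) w).2)
        : Option (Bool × Bool) × ℕ) := by
  induction w with
  | nil => rfl
  | cons a w ih =>
    have h1 : ∀ g : ℕ → KM, ev g (a :: w) = mulK (g a) (ev g w) := fun g => by
      simp [ev, mul_def]
    rw [h1, h1, ih]
    simp only [mulK, dec_enc, List.map_cons, List.sum_cons]
    refine Prod.ext rfl ?_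
    simp only
    omega

theorem ev_count (x : ℕ) (w : List ℕ) :
    ev (fun y => dec (if y = x then 5 else 0)) w
      = ((none, w.count x) : Option (Bool × Bool) × ℕ) := by
  induction w with
  | nil => rfl
  | cons a w ih =>
    have h1 : ∀ g : ℕ → KM, ev g (a :: w) = mulK (g a) (ev g w) := fun g => by
      simp [ev, mul_def]
    rw [h1, ih]
    by_cases h : a = x
    · subst h
      simp [mulK, dec, tmul, tk, add_comm]
      rfl
    · simp [mulK, dec, tmul, tk, h]
      rfl

theorem ev_iff (w w' : List ℕ) :
    (∀ g, ev g w = ev g w') ↔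
      ∀ f : ℕ → Fin 6, ev (fun x => dec (f x)) w = ev (fun x => dec (f x)) w' := by
  refine ⟨fun h f => h _, fun h g => ?_⟩
  have hp : w.Perm w' := by
    rw [List.perm_iff_count]
    intro x
    have := h (fun y => if y = x then 5 else 0)
    have h2 := congrArg Prod.snd ((ev_count x w).symm.trans (this.trans (ev_count x w')))
    convert h2
  rw [ev_split g w, ev_split g w', h, (hp.map _).sum_eq]

/-- Assignment coded by a natural number. -/
def asg (m x : ℕ) : Fin 6 := Fin.ofNat 6 (m / 6 ^ x)

theorem exists_asg (f : ℕ → Fin 6) (N : ℕ) : ∃ m < 6 ^ N, ∀ x < N, asg m x = f x := by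
  induction N generalizing f with
  | zero => exact ⟨0, by simp, by simp⟩
  | succ N ih =>
    obtain ⟨m, hm, h⟩ := ih (fun x => f (x + 1))
    have h0 := (f 0).isLt
    refine ⟨6 * m + f 0, by rw [pow_succ]; omega, ?_⟩
    intro x hx
    cases x with
    | zero => apply Fin.ext; simp [asg, Nat.mod_eq_of_lt h0]
    | succ x =>
      rw [← h x (by omega)]
      unfold asg
      rw [pow_succ', ← Nat.div_div_eq_div_mul]
      congr 2
      omega

/-- Evaluate at coded assignment. -/
def evm (m : ℕ) (w : List ℕ) : KM := w.foldl (fun s x => s * dec (asg m x)) 1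

theorem evm_eq (m : ℕ) (w : List ℕ) : evm m w = ev (fun x => dec (asg m x)) w := by
  have : ∀ s, w.foldl (fun s x => s * dec (asg m x)) s = s * ev (fun x => dec (asg m x)) w := by
    induction w with
    | nil => intro s; simp [ev]
    | cons a w ih => intro s; simp [ih, ev, mul_assoc]
  rw [evm, this, one_mul]

/-- Bound. -/
def bd (w : List ℕ) : ℕ := w.foldl (fun s x => s + x + 1) 0

theorem lt_bd (w : List ℕ) : ∀ x ∈ w, x < bd w := by
  have h2 : ∀ (v : List ℕ) s, s ≤ v.foldl (fun s x => s + x + 1) s := by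
    intro v
    induction v with
    | nil => intro s; exact le_rfl
    | cons a v ih => intro s; exact le_trans (by omega) (ih (s + a + 1))
  have : ∀ (v : List ℕ) s, ∀ x ∈ v, x < v.foldl (fun s x => s + x + 1) s := by
    intro v
    induction v with
    | nil => simp
    | cons a v ih =>
      intro s x hx
      rw [List.mem_cons] at hx
      rcases hx with rfl | hx
      · exact lt_of_lt_of_le (by omega) (h2 v (s + x + 1))
      · exact ih _ x hx
  exact this w 0

theorem final_iff (w w' : List ℕ) :
    HoldsIn K3 w w' ↔ ∀ m < 6 ^ (bd w + bd w'), evm m w = evm m w' := by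
  rw [holds_iff, holds_iff_ev, ev_iff]
  constructor
  · intro h m _
    rw [evm_eq, evm_eq, h]
  · intro h f
    obtain ⟨m, hm, hf⟩ := exists_asg f (bd w + bd w')
    have := h m hm
    rw [evm_eq, evm_eq] at this
    have k1 : ev (fun x => dec (asg m x)) w = ev (fun x => dec (f x)) w := by
      unfold ev
      congr 1
      apply List.map_congr_left
      intro x hx
      rw [hf x (by have := lt_bd w x hx; omega)]
    have k2 : ev (fun x => dec (asg m x)) w' = ev (fun x => dec (f x)) w' := by
      unfold ev
      congr 1
      apply List.map_congr_left
      intro x hx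
      rw [hf x (by have := lt_bd w' x hx; omega)]
    rw [← k1, ← k2, this]

instance : Primcodable KM := inferInstanceAs (Primcodable (Option (Bool × Bool) × ℕ))

theorem prim_mul : Primrec₂ (fun x y : KM => x * y) := by
  have hf : Primrec (fun x : KM => (x.1 : Option (Bool × Bool))) :=
    (Primrec.fst : Primrec (Prod.fst : Option (Bool × Bool) × ℕ → _))
  have hs : Primrec (fun x : KM => (x.2 : ℕ)) :=
    (Primrec.snd : Primrec (Prod.snd : Option (Bool × Bool) × ℕ → _))
  have ht : Primrec₂ tmul := Primrec.dom_finite _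
  have hk : Primrec₂ tk := Primrec.dom_finite _
  have a1 := hf.comp (Primrec.fst : Primrec (Prod.fst : KM × KM → _))
  have a2 := hf.comp (Primrec.snd : Primrec (Prod.snd : KM × KM → _))
  have n1 := hs.comp (Primrec.fst : Primrec (Prod.fst : KM × KM → _))
  have n2 := hs.comp (Primrec.snd : Primrec (Prod.snd : KM × KM → _))
  exact (ht.comp a1 a2).pair
    (Primrec.nat_add.comp (Primrec.nat_add.comp n1 n2) (hk.comp a1 a2))

theorem prim_pow : Primrec (fun n : ℕ => 6 ^ n) := by
  have : Primrec (Nat.rec (motive := fun _ => ℕ) 1 (fun _ s => s * 6)) :=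
    Primrec.nat_rec₁ 1 (Primrec.nat_mul.comp Primrec.snd (Primrec.const 6))
  refine this.of_eq fun n => ?_
  induction n with
  | zero => rfl
  | succ n ih => rw [pow_succ, ← ih]

theorem prim_dec_asg : Primrec₂ (fun m x : ℕ => dec (asg m x)) := by
  have h6 : Primrec (fun n : ℕ => dec (Fin.ofNat 6 n)) := by
    have h : Primrec (fun n : ℕ => (([0, 1, 2, 3, 4, 5] : List (Fin 6)).map dec).getD (n % 6) 1) :=
      (Primrec.list_getD 1).comp (Primrec.const _)
        (Primrec.nat_mod.comp Primrec.id (Primrec.const 6))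
    refine h.of_eq fun n => ?_
    have h1 : Fin.ofNat 6 n = Fin.ofNat 6 (n % 6) := by
      apply Fin.ext; simp
    rw [h1]
    have h2 : n % 6 < 6 := Nat.mod_lt _ (by norm_num)
    generalize n % 6 = k at h2
    interval_cases k <;> rfl
  exact h6.comp (Primrec.nat_div.comp Primrec.fst (prim_pow.comp Primrec.snd))

theorem prim_evm : Primrec₂ evm := by
  refine Primrec.list_foldl (f := fun p : ℕ × List ℕ => p.2) (g := fun _ => (1 : KM))
    (h := fun p q => q.1 * dec (asg p.1 q.2)) Primrec.snd (Primrec.const 1) ?_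
  exact prim_mul.comp (Primrec.fst.comp Primrec.snd)
    (prim_dec_asg.comp (Primrec.fst.comp Primrec.fst) (Primrec.snd.comp Primrec.snd))

theorem prim_bd : Primrec bd := by
  refine Primrec.list_foldl (f := fun p : List ℕ => p) (g := fun _ => 0)
    (h := fun _ q => q.1 + q.2 + 1) Primrec.id (Primrec.const 0) ?_
  exact Primrec.succ.comp (Primrec.nat_add.comp (Primrec.fst.comp Primrec.snd)
    (Primrec.snd.comp Primrec.snd))

theorem prim_final : PrimrecPred fun p : List ℕ × List ℕ => HoldsIn K3 p.1 p.2 := by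
  have hR : PrimrecRel (fun (m : ℕ) (p : List ℕ × List ℕ) => evm m p.1 = evm m p.2) :=
    Primrec.eq.comp (prim_evm.comp Primrec.fst (Primrec.fst.comp Primrec.snd))
      (prim_evm.comp Primrec.fst (Primrec.snd.comp Primrec.snd))
  have hb : Primrec (fun p : List ℕ × List ℕ => 6 ^ (bd p.1 + bd p.2)) :=
    prim_pow.comp (Primrec.nat_add.comp (prim_bd.comp Primrec.fst) (prim_bd.comp Primrec.snd))
  have hF : PrimrecRel (fun (n : ℕ) (p : List ℕ × List ℕ) =>
      ∀ m < n, evm m p.1 = evm m p.2) :=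
    (hR.forall_mem_list.comp (Primrec.list_range.comp Primrec.fst) Primrec.snd).of_eq
      (fun p => by simp)
  have hG : PrimrecPred (fun p : List ℕ × List ℕ =>
      ∀ m < 6 ^ (bd p.1 + bd p.2), evm m p.1 = evm m p.2) := hF.comp hb Primrec.id
  exact hG.of_eq fun p => (final_iff p.1 p.2).symm

end KM

/-- The identity checking problem for the Kauffman monoid `K₃` is decidable: the set of
pairs `(w, w')` of words over the countably infinite decidable alphabet `ℕ` such that
the identity `w ≍ w'` holds in `K₃` is a decidable (computable) predicate. -/
theorem K3_identityChecking_decidable :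
    ComputablePred fun p : List ℕ × List ℕ => HoldsIn K3 p.1 p.2 := KM.prim_final.computablePred
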